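/- Let Q be an acyclic conjunctive query and 𝒱 a finite set of conjunctive-query views. If Q is 𝒱-rewritable, then there is an acyclic 𝒱-rewriting of Q. -/

import Mathlib

/-- A relational atom (or fact): a relation symbol with a list of arguments.
Arguments are natural numbers, serving both as variables and as data values. -/
structure Atom where
  rel : ℕ
  args : List ℕ
deriving DecidableEq

/-- Apply a substitution to an atom. -/
def mapAtom (f : ℕ → ℕ) (A : Atom) : Atom := ⟨A.rel, A.args.map f⟩

/-- The variables of an atom. -/
def Atom.vars (A : Atom) : Finset ℕ := A.args.toFinset

/-- The variables of a finite set of atoms. -/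
def varsOf (B : Finset Atom) : Finset ℕ := B.biUnion Atom.vars

/-- A conjunctive query: a head atom and a finite set of body atoms. -/
structure CQ where
  head : Atom
  body : Finset Atom
deriving DecidableEq

/-- All variables of a conjunctive query. -/
def CQ.vars (Q : CQ) : Finset ℕ := Q.head.vars ∪ varsOf Q.body

/-- A schema: a set of relation symbols together with an arity function. -/
structure Schema where
  rels : Set ℕ
  ar : ℕ → ℕ

/-- An atom (or fact) over a schema. -/
def atomOver (σ : Schema) (A : Atom) : Prop :=
  A.rel ∈ σ.rels ∧ A.args.length = σ.ar A.rel

/-- `Q` is a (well-formed) conjunctive query over schema `σ`: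
nonempty body of σ-atoms, head relation symbol not in σ, and safety. -/
def isCQ (σ : Schema) (Q : CQ) : Prop :=
  Q.body.Nonempty ∧ (∀ A ∈ Q.body, atomOver σ A) ∧
  Q.head.rel ∉ σ.rels ∧ Q.head.vars ⊆ varsOf Q.body

/-- A database is a set of facts (finiteness is imposed where needed). -/
abbrev Database := Set Atom

/-- A database over a schema. -/
def isDBOver (σ : Schema) (D : Database) : Prop := ∀ F ∈ D, atomOver σ F

/-- The result of a conjunctive query on a database. -/
def evalCQ (Q : CQ) (D : Database) : Set Atom :=
  { F | ∃ ν : ℕ → ℕ, (∀ A ∈ Q.body, mapAtom ν A ∈ D) ∧ mapAtom ν Q.head = F }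

/-- Containment of conjunctive queries. -/
def containedCQ (Q1 Q2 : CQ) : Prop :=
  ∀ D : Database, D.Finite → evalCQ Q1 D ⊆ evalCQ Q2 D

/-- Equivalence of conjunctive queries. -/
def equivCQ (Q1 Q2 : CQ) : Prop :=
  ∀ D : Database, D.Finite → evalCQ Q1 D = evalCQ Q2 D

/-- A conjunctive query is minimal if no equivalent CQ has strictly fewer body atoms. -/
def isMinimal (Q : CQ) : Prop :=
  ∀ Q2 : CQ, equivCQ Q Q2 → Q.body.card ≤ Q2.body.card

/-- A homomorphism from `Q2` to `Q1`. -/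
def isHom (h : ℕ → ℕ) (Q2 Q1 : CQ) : Prop :=
  (∀ A ∈ Q2.body, mapAtom h A ∈ Q1.body) ∧ mapAtom h Q2.head = Q1.head

/-- A body homomorphism from `Q2` to `Q1`. -/
def isBodyHom (h : ℕ → ℕ) (Q2 Q1 : CQ) : Prop :=
  ∀ A ∈ Q2.body, mapAtom h A ∈ Q1.body

/-- A set of views over σ: each view is a CQ over σ and views have
pairwise distinct head relation symbols. -/
def isViewSet (σ : Schema) (𝒱 : Finset CQ) : Prop :=
  (∀ V ∈ 𝒱, isCQ σ V) ∧
  ∀ V ∈ 𝒱, ∀ W ∈ 𝒱, V ≠ W → V.head.rel ≠ W.head.rel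

/-- The 𝒱-defined database 𝒱(D). -/
def viewDB (𝒱 : Finset CQ) (D : Database) : Database :=
  ⋃ V ∈ 𝒱, evalCQ V D

/-- `Q'` is a CQ over the schema σ_𝒱 of the head relations of the views 𝒱. -/
def overViews (𝒱 : Finset CQ) (Q' : CQ) : Prop :=
  Q'.body.Nonempty ∧
  (∀ A ∈ Q'.body, ∃ V ∈ 𝒱, A.rel = V.head.rel ∧ A.args.length = V.head.args.length) ∧
  (∀ V ∈ 𝒱, Q'.head.rel ≠ V.head.rel) ∧
  Q'.head.vars ⊆ varsOf Q'.body

/-- `Q'` is a 𝒱-rewriting of `Q`: `Q'` is over σ_𝒱 and `Q'(𝒱(D)) = Q(D)`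
for every (finite) database `D` over σ. -/
def isRewriting (σ : Schema) (𝒱 : Finset CQ) (Q Q' : CQ) : Prop :=
  overViews 𝒱 Q' ∧
  ∀ D : Database, D.Finite → isDBOver σ D →
    evalCQ Q' (viewDB 𝒱 D) = evalCQ Q D

/-- `T` is a join tree for the atom set `B`. -/
def joinTreeProp (B : Finset Atom) (T : SimpleGraph {A : Atom // A ∈ B}) : Prop :=
  T.IsTree ∧
  ∀ (x : ℕ) (A A' : {A : Atom // A ∈ B}) (p : T.Walk A A'), p.IsPath →
    x ∈ A.1.vars → x ∈ A'.1.vars → ∀ C ∈ p.support, x ∈ C.1.vars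

/-- The atom set `B` has a join tree. -/
def hasJoinTree (B : Finset Atom) : Prop :=
  ∃ T : SimpleGraph {A : Atom // A ∈ B}, joinTreeProp B T

/-- A conjunctive query is acyclic if its body has a join tree. -/
def isAcyclicCQ (Q : CQ) : Prop := hasJoinTree Q.body

/-- A conjunctive query is free-connex acyclic. -/
def isFreeConnex (Q : CQ) : Prop :=
  isAcyclicCQ Q ∧ hasJoinTree (insert Q.head Q.body)

/-- The bridge variables of `𝒜 ⊆ body(Q)`. -/
def bvars (Q : CQ) (𝒜 : Finset Atom) : Finset ℕ :=
  varsOf 𝒜 ∩ (Q.head.vars ∪ varsOf (Q.body \ 𝒜))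

/-- An application of a view `V`: a substitution that does not unify any
quantified variable of `V` with another variable of `V`. -/
def isApplication (V : CQ) (α : ℕ → ℕ) : Prop :=
  ∀ x ∈ varsOf V.body, x ∉ V.head.vars →
    ∀ y ∈ CQ.vars V, y ≠ x → α x ≠ α y

/-- The query α(V). -/
def applyCQ (α : ℕ → ℕ) (V : CQ) : CQ :=
  ⟨mapAtom α V.head, V.body.image (mapAtom α)⟩

/-- `(𝒜, V, α, ψ)` is a cover description for `Q`. -/
def isCoverDesc (Q : CQ) (𝒜 : Finset Atom) (V : CQ) (α ψ : ℕ → ℕ) : Prop :=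
  𝒜 ⊆ Q.body ∧ isApplication V α ∧
  𝒜 ⊆ V.body.image (mapAtom α) ∧
  bvars Q 𝒜 ⊆ V.head.vars.image α ∧
  isBodyHom ψ (applyCQ α V) Q ∧
  ∀ x ∈ varsOf 𝒜, ψ x = x

/-- A cover partition for `Q` over `𝒱`: a collection of cover descriptions
whose atom sets partition `body(Q)`. -/
def isCoverPartition (Q : CQ) (𝒱 : Finset CQ) (m : ℕ)
    (𝒜 : Fin m → Finset Atom) (V : Fin m → CQ) (α ψ : Fin m → ℕ → ℕ) : Prop :=
  (∀ i, V i ∈ 𝒱 ∧ isCoverDesc Q (𝒜 i) (V i) (α i) (ψ i)) ∧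
  ∀ A ∈ Q.body, ∃! i, A ∈ 𝒜 i

/-- Consistency of a cover partition: a variable of any `α_j(V_j)` lies in the
range of another `α_i` only if it also lies in `bvars(𝒜_j)`. -/
def isConsistent (Q : CQ) (m : ℕ) (𝒜 : Fin m → Finset Atom) (V : Fin m → CQ)
    (α : Fin m → ℕ → ℕ) : Prop :=
  ∀ i j : Fin m, i ≠ j → ∀ z ∈ CQ.vars (applyCQ (α j) (V j)),
    (∃ x ∈ CQ.vars (V i), α i x = z) → z ∈ bvars Q (𝒜 j)

/-- The query `Q_𝒞` induced by a (consistent) cover partition. -/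
def inducedCQ (Q : CQ) (m : ℕ) (V : Fin m → CQ) (α : Fin m → ℕ → ℕ) : CQ :=
  ⟨Q.head, Finset.image (fun i => mapAtom (α i) (V i).head) Finset.univ⟩

/-- Quantified variable disjointness for a family of view applications. -/
def QVD (m : ℕ) (V : Fin m → CQ) (α : Fin m → ℕ → ℕ) : Prop :=
  ∀ i j : Fin m, i ≠ j → ∀ x ∈ varsOf (V i).body, x ∉ (V i).head.vars →
    ∀ y ∈ CQ.vars (V j), α i x ≠ α j y

/-- `QE` is an expansion of `Q'` with respect to the views `𝒱`. -/
def isExpansion (𝒱 : Finset CQ) (Q' QE : CQ) : Prop :=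
  ∃ (m : ℕ) (A' : Fin m → Atom) (V : Fin m → CQ) (α : Fin m → ℕ → ℕ),
    (∀ i, V i ∈ 𝒱 ∧ isApplication (V i) (α i) ∧ A' i = mapAtom (α i) (V i).head) ∧
    Q'.body = Finset.image A' Finset.univ ∧
    QVD m V α ∧
    QE.head = Q'.head ∧
    QE.body = Finset.biUnion Finset.univ (fun i => (V i).body.image (mapAtom (α i)))

/-- `atoms(x)`: the body atoms of `Q` containing the variable `x`. -/
def atomsWith (Q : CQ) (x : ℕ) : Finset Atom :=
  Q.body.filter (fun A => x ∈ A.vars)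

/-- Hierarchical conjunctive queries. -/
def isHierarchical (Q : CQ) : Prop :=
  ∀ x y : ℕ, atomsWith Q x ⊆ atomsWith Q y ∨ atomsWith Q y ⊆ atomsWith Q x ∨
    atomsWith Q x ∩ atomsWith Q y = ∅

/-- q-hierarchical conjunctive queries. -/
def isQHierarchical (Q : CQ) : Prop :=
  isHierarchical Q ∧ ∀ x y : ℕ, atomsWith Q x ⊂ atomsWith Q y →
    x ∈ Q.head.vars → y ∈ Q.head.vars

/-- `P` is a partition of `body(Q)` witnessing weak head arity at most `k`. -/
def witnessesWHA (Q : CQ) (k n : ℕ) (P : Fin n → Finset Atom) : Prop :=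
  (∀ i, (P i).Nonempty) ∧ (∀ i, P i ⊆ Q.body) ∧ (∀ A ∈ Q.body, ∃! i, A ∈ P i) ∧
  (∀ i, (varsOf (P i) ∩ Q.head.vars).card ≤ k) ∧
  (∀ i j, i ≠ j → ∀ x ∈ varsOf (P i), x ∈ varsOf (P j) → x ∈ Q.head.vars)

/-- `Q` has weak head arity at most `k`. -/
def hasWHAle (Q : CQ) (k : ℕ) : Prop := ∃ n P, witnessesWHA Q k n P

/-- The weak head arity of `Q`. -/
noncomputable def weakHeadArity (Q : CQ) : ℕ := sInf {k | hasWHAle Q k}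

/-- The cover graph of `Q`: vertices are the body atoms, with an edge between
two atoms iff they share a variable not occurring in the head. -/
def coverGraph (Q : CQ) : SimpleGraph {A : Atom // A ∈ Q.body} :=
  SimpleGraph.fromRel (fun A B => ∃ x, x ∈ A.1.vars ∧ x ∈ B.1.vars ∧ x ∉ Q.head.vars)

/-- A subset `s` of the atom set `B` is connected in the (join) tree `T`. -/
def connectedIn (B : Finset Atom) (T : SimpleGraph {A : Atom // A ∈ B}) (s : Finset Atom) : Prop :=
  (T.induce {A : {A : Atom // A ∈ B} | A.1 ∈ s}).Connected

theorem Atom.eq_iff {A C : Atom} : A = C ↔ A.rel = C.rel ∧ A.args = C.args := by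
  cases A
  cases C
  simp

theorem mapAtom_mapAtom (f g : ℕ → ℕ) (A : Atom) :
    mapAtom f (mapAtom g A) = mapAtom (fun x => f (g x)) A := by
  simp [mapAtom, Function.comp_def]

theorem mapAtom_id (A : Atom) : mapAtom (fun x => x) A = A := by
  simp [mapAtom]

theorem mem_vars {A : Atom} {x : ℕ} : x ∈ A.vars ↔ x ∈ A.args := by
  simp [Atom.vars]

theorem mem_vars_mapAtom {f : ℕ → ℕ} {A : Atom} {z : ℕ} :
    z ∈ (mapAtom f A).vars ↔ ∃ x ∈ A.vars, f x = z := by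
  simp [mapAtom, Atom.vars]

theorem mem_varsOf {B : Finset Atom} {x : ℕ} : x ∈ varsOf B ↔ ∃ A ∈ B, x ∈ A.vars := by
  simp [varsOf]

theorem mapAtom_eq_iff {f g : ℕ → ℕ} {A : Atom} :
    mapAtom f A = mapAtom g A ↔ ∀ x ∈ A.vars, f x = g x := by
  simp [mapAtom, mem_vars]

/-- Two atoms unified by `h` and `α` are also unified by any two maps `κ` and `w` that
agree whenever `h` and `α` do. -/
theorem mapAtom_eq_of_unified {h α κ w : ℕ → ℕ} {A A₀ : Atom}
    (heq : mapAtom α A₀ = mapAtom h A)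
    (hagree : ∀ y ∈ A.vars, ∀ x ∈ A₀.vars, α x = h y → w x = κ y) :
    mapAtom w A₀ = mapAtom κ A := by
  obtain ⟨R, l⟩ := A
  obtain ⟨R₀, l₀⟩ := A₀
  simp only [mapAtom, Atom.mk.injEq, mem_vars] at *
  obtain ⟨hR, hl⟩ := heq
  refine ⟨hR, ?_⟩
  induction l₀ generalizing l with
  | nil =>
    have : l = [] := by simpa using hl.symm
    simp [this]
  | cons a t ih =>
    cases l with
    | nil => simp at hl
    | cons b s =>
      simp only [List.map_cons, List.cons.injEq] at hl ⊢
      exact ⟨hagree b (by simp) a (by simp) hl.1,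
        ih s (fun y hy x hx => hagree y (by simp [hy]) x (by simp [hx])) hl.2⟩

theorem mem_viewDB {𝒱 : Finset CQ} {D : Database} {F : Atom} :
    F ∈ viewDB 𝒱 D ↔
      ∃ V ∈ 𝒱, ∃ ν : ℕ → ℕ, (∀ A ∈ V.body, mapAtom ν A ∈ D) ∧ mapAtom ν V.head = F := by
  simp [viewDB, evalCQ]

/-- Atom sets that can be built by adding atoms one at a time, each sharing with its
predecessors only variables of a single one of them. -/
inductive EarOrder : Finset Atom → Prop
  | single (A : Atom) : EarOrder {A}
  | extend {B : Finset Atom} {A C : Atom} : EarOrder B → C ∈ B → A ∉ B →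
      A.vars ∩ varsOf B ⊆ C.vars → EarOrder (insert A B)

theorem EarOrder.exists_graph {B : Finset Atom} (hB : EarOrder B) :
    B.Nonempty ∧ ∃ G : SimpleGraph Atom, G.IsAcyclic ∧ (∀ A A', G.Adj A A' → A ∈ B) ∧
      ∀ A ∈ B, ∀ A' ∈ B, ∃ p : G.Walk A A',
        ∀ D ∈ p.support, D ∈ B ∧ A.vars ∩ A'.vars ⊆ D.vars := by
  classical
  induction hB with
  | single A =>
    refine ⟨by simp, ⊥, by simp, by simp, ?_⟩
    simp only [Finset.mem_singleton, forall_eq]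
    exact ⟨.nil, by simp⟩
  | @extend B A C _ hC hA hsub ih =>
    obtain ⟨-, G, hG, hadj, hwalk⟩ := ih
    refine ⟨by simp, G ⊔ SimpleGraph.edge A C, ?_, ?_, ?_⟩
    · refine hG.sup_edge_of_not_reachable ?_
      rintro ⟨p⟩
      cases p with
      | nil => exact hA hC
      | cons e _ => exact hA (hadj _ _ e)
    · intro X Y hXY
      rw [SimpleGraph.sup_adj, SimpleGraph.edge_adj] at hXY
      rcases hXY with hXY | ⟨⟨rfl, rfl⟩ | ⟨rfl, rfl⟩, -⟩
      · exact Finset.mem_insert_of_mem (hadj _ _ hXY)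
      · exact Finset.mem_insert_self _ _
      · exact Finset.mem_insert_of_mem hC
    · have hAC : (G ⊔ SimpleGraph.edge A C).Adj A C := by
        rw [SimpleGraph.sup_adj, SimpleGraph.edge_adj]
        exact .inr ⟨.inl ⟨rfl, rfl⟩, fun e => hA (e ▸ hC)⟩
      have hnew : ∀ D ∈ B, ∃ p : (G ⊔ SimpleGraph.edge A C).Walk A D,
          ∀ X ∈ p.support, X ∈ insert A B ∧ A.vars ∩ D.vars ⊆ X.vars := by
        intro D hD
        obtain ⟨p, hp⟩ := hwalk C hC D hD
        refine ⟨.cons hAC (p.mapLe le_sup_left), ?_⟩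
        intro X hX
        simp only [SimpleGraph.Walk.support_cons, List.mem_cons,
          SimpleGraph.Walk.support_mapLe_eq_support] at hX
        rcases hX with rfl | hX
        · exact ⟨Finset.mem_insert_self _ _, Finset.inter_subset_left⟩
        · refine ⟨Finset.mem_insert_of_mem (hp X hX).1, fun x hx => (hp X hX).2 ?_⟩
          rw [Finset.mem_inter] at hx ⊢
          exact ⟨hsub (Finset.mem_inter.2 ⟨hx.1, mem_varsOf.2 ⟨D, hD, hx.2⟩⟩), hx.2⟩
      intro X hX Y hY
      rcases Finset.mem_insert.1 hX with rfl | hXB <;> rcases Finset.mem_insert.1 hY with rfl | hYB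
      · exact ⟨.nil, by simp⟩
      · exact hnew Y hYB
      · obtain ⟨p, hp⟩ := hnew X hXB
        refine ⟨p.reverse, fun D hD => ?_⟩
        rw [Finset.inter_comm]
        exact hp D (by simpa using hD)
      · obtain ⟨p, hp⟩ := hwalk X hXB Y hYB
        refine ⟨p.mapLe le_sup_left, fun D hD => ?_⟩
        rw [SimpleGraph.Walk.support_mapLe_eq_support] at hD
        exact ⟨Finset.mem_insert_of_mem (hp D hD).1, (hp D hD).2⟩

theorem EarOrder.exists_joinTree {B : Finset Atom} (hB : EarOrder B) : hasJoinTree B := by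
  classical
  obtain ⟨⟨A₀, hA₀⟩, G, hG, -, hwalk⟩ := hB.exists_graph
  have hT : (G.comap (Subtype.val : {A // A ∈ B} → Atom)).IsAcyclic :=
    hG.of_comap (Function.Embedding.subtype _)
  have hwalk' : ∀ A A' : {A // A ∈ B}, ∃ p : (G.comap Subtype.val).Walk A A',
      ∀ D ∈ p.support, A.1.vars ∩ A'.1.vars ⊆ D.1.vars := by
    intro A A'
    obtain ⟨p, hp⟩ := hwalk A A.2 A' A'.2
    have hs : ∀ D ∈ p.support, D ∈ {A | A ∈ B} := fun D hD => (hp D hD).1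
    have hsupp : ∀ D ∈ (p.induce _ hs).support, D.1 ∈ p.support := by
      intro D hD
      rw [SimpleGraph.Walk.support_induce] at hD
      simpa using List.mem_map_of_mem (f := Subtype.val) hD
    exact ⟨p.induce _ hs, fun D hD => (hp D (hsupp D hD)).2⟩
  have : Nonempty {A // A ∈ B} := ⟨⟨A₀, hA₀⟩⟩
  refine ⟨_, ⟨⟨fun A A' => ?_⟩, hT⟩, ?_⟩
  · obtain ⟨p, -⟩ := hwalk' A A'
    exact ⟨p⟩
  · intro x A A' p hp hxA hxA' C hC
    obtain ⟨q, hq⟩ := hwalk' A A'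
    have := hT.subsingleton_path A A'
    obtain rfl : p = q.toPath := congrArg Subtype.val (Subsingleton.elim ⟨p, hp⟩ q.toPath)
    exact hq C (q.support_toPath_subset_support hC) (Finset.mem_inter.2 ⟨hxA, hxA'⟩)

theorem EarOrder.of_hasJoinTree {B : Finset Atom} (hB : hasJoinTree B) : EarOrder B := by
  classical
  obtain ⟨T, hT, hpath⟩ := hB
  let P : Finset Atom → Prop := fun S => EarOrder S ∧
    ∀ C D : {A // A ∈ B}, C.1 ∈ S → D.1 ∈ S →
      ∃ p : T.Walk C D, p.IsPath ∧ ∀ X ∈ p.support, X.1 ∈ S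
  obtain ⟨A₀⟩ := hT.connected.nonempty
  obtain ⟨S, hS, hmax⟩ := (B.powerset.filter P).exists_max_image Finset.card
    ⟨{A₀.1}, by
      simp only [Finset.mem_filter, Finset.mem_powerset, Finset.singleton_subset_iff,
        Finset.mem_singleton, P]
      refine ⟨A₀.2, .single _, fun C D hC hD => ?_⟩
      obtain rfl : C = D := Subtype.ext (hC.trans hD.symm)
      exact ⟨.nil, by simp, by simpa using hC⟩⟩
  simp only [Finset.mem_filter, Finset.mem_powerset] at hS hmax
  obtain ⟨hSB, hS, hSpath⟩ := hS
  obtain ⟨C₀, hC₀⟩ := hS.exists_graph.1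
  by_contra hne
  obtain ⟨Y, hYB, hYS⟩ : ∃ Y ∈ B, Y ∉ S := by
    by_contra! hcon
    exact hne (hSB.antisymm hcon ▸ hS)
  obtain ⟨w⟩ := hT.connected.preconnected ⟨C₀, hSB hC₀⟩ ⟨Y, hYB⟩
  obtain ⟨⟨⟨C, A⟩, hCA⟩, -, hC, hA⟩ := w.exists_boundary_dart {X | X.1 ∈ S} hC₀ hYS
  simp only [Set.mem_ofPred_eq] at hC hA hCA
  have hnew : ∀ D : {A // A ∈ B}, D.1 ∈ S → ∃ p : T.Walk A D, p.IsPath ∧ C ∈ p.support ∧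
      ∀ X ∈ p.support, X.1 ∈ insert A.1 S := by
    intro D hD
    obtain ⟨p, hp, hpS⟩ := hSpath C D hC hD
    refine ⟨.cons hCA.symm p, ?_, by simp, ?_⟩
    · rw [SimpleGraph.Walk.cons_isPath_iff]
      exact ⟨hp, fun hAp => hA (hpS A hAp)⟩
    · intro X hX
      rw [SimpleGraph.Walk.support_cons, List.mem_cons] at hX
      rcases hX with rfl | hX
      · exact Finset.mem_insert_self _ _
      · exact Finset.mem_insert_of_mem (hpS X hX)
  have hins := hmax (insert A.1 S) ⟨Finset.insert_subset A.2 hSB, .extend hS hC hA ?_, ?_⟩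
  · rw [Finset.card_insert_of_notMem hA] at hins
    omega
  · intro x hx
    obtain ⟨hxA, hxS⟩ := Finset.mem_inter.1 hx
    obtain ⟨D, hD, hxD⟩ := mem_varsOf.1 hxS
    obtain ⟨p, hp, hCp, -⟩ := hnew ⟨D, hSB hD⟩ hD
    exact hpath x _ _ p hp hxA hxD C hCp
  · intro X Y hX hY
    rcases Finset.mem_insert.1 hX with hXA | hXS <;> rcases Finset.mem_insert.1 hY with hYA | hYS
    · obtain rfl : X = Y := Subtype.ext (hXA.trans hYA.symm)
      exact ⟨.nil, by simp, by simpa using hX⟩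
    · obtain rfl : X = A := Subtype.ext hXA
      obtain ⟨p, hp, -, hpS⟩ := hnew Y hYS
      exact ⟨p, hp, hpS⟩
    · obtain rfl : Y = A := Subtype.ext hYA
      obtain ⟨p, hp, -, hpS⟩ := hnew X hXS
      exact ⟨p.reverse, hp.reverse, by simpa using hpS⟩
    · obtain ⟨p, hp, hpS⟩ := hSpath X Y hXS hYS
      exact ⟨p, hp, fun Z hZ => Finset.mem_insert_of_mem (hpS Z hZ)⟩

/-- Unravelling along an ear order: every atom `A` gets a copy of `i A` with renamed variables.
The copies form an ear order, and they agree on the variables `g y` for visible common variables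
`y`; copies for atoms with a common invisible variable coincide. -/
theorem EarOrder.exists_renaming {B : Finset Atom} (hB : EarOrder B) (i : Atom → Atom)
    (vis : ℕ → Prop) (g : ℕ → ℕ)
    (hvis : ∀ A ∈ B, ∀ y ∈ A.vars, vis y → g y ∈ (i A).vars)
    (hinvis : ∀ A ∈ B, ∀ C ∈ B, ∀ y ∈ A.vars, y ∈ C.vars → ¬ vis y → i A = i C) :
    ∃ r : Atom → ℕ → ℕ, (∀ A ∈ B, ∀ v, (r A v).unpair.2 = v) ∧
      EarOrder (B.image fun A => mapAtom (r A) (i A)) ∧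
      ∀ A ∈ B, ∀ C ∈ B, ∀ y ∈ A.vars, y ∈ C.vars →
        (vis y → r A (g y) = r C (g y)) ∧
        (¬ vis y → mapAtom (r A) (i A) = mapAtom (r C) (i C)) := by
  classical
  suffices h : ∃ r : Atom → ℕ → ℕ, ((∀ A ∈ B, ∀ v, (r A v).unpair.2 = v) ∧
      EarOrder (B.image fun A => mapAtom (r A) (i A)) ∧
      ∀ A ∈ B, ∀ C ∈ B, ∀ y ∈ A.vars, y ∈ C.vars →
        (vis y → r A (g y) = r C (g y)) ∧
        (¬ vis y → mapAtom (r A) (i A) = mapAtom (r C) (i C))) ∧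
      ∃ N, ∀ A ∈ B, ∀ v, (r A v).unpair.1 < N by
    obtain ⟨r, hr, -⟩ := h
    exact ⟨r, hr⟩
  induction hB with
  | single A =>
    refine ⟨fun _ v => Nat.pair 0 v, ⟨by simp, ?_, ?_⟩, 1, by simp⟩
    · rw [Finset.image_singleton]
      exact .single _
    · simp only [Finset.mem_singleton]
      rintro _ rfl _ rfl
      simp
  | @extend B A C _ hC hA hsub ih =>
    obtain ⟨r, ⟨hdec, hear, hagree⟩, N, hN⟩ :=
      ih (fun D hD => hvis D (Finset.mem_insert_of_mem hD))
        (fun D hD D' hD' => hinvis D (Finset.mem_insert_of_mem hD) D' (Finset.mem_insert_of_mem hD'))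
    have hAi := Finset.mem_insert_self A B
    have hCi := (Finset.mem_insert_of_mem hC : C ∈ insert A B)
    obtain ⟨ρ, hρdec, hρN, hρear, hρagree⟩ : ∃ ρ : ℕ → ℕ, (∀ v, (ρ v).unpair.2 = v) ∧
        (∀ v, (ρ v).unpair.1 < N + 1) ∧
        EarOrder (insert (mapAtom ρ (i A)) (B.image fun A => mapAtom (r A) (i A))) ∧
        ∀ y ∈ A.vars, y ∈ C.vars → (vis y → ρ (g y) = r C (g y)) ∧
          (¬ vis y → mapAtom ρ (i A) = mapAtom (r C) (i C)) := by
      by_cases hi : i A = i C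
      · refine ⟨r C, hdec C hC, fun v => (hN C hC v).trans (Nat.lt_succ_self _), ?_, ?_⟩
        · rwa [Finset.insert_eq_of_mem (hi ▸ Finset.mem_image_of_mem (fun A => mapAtom (r A) (i A)) hC)]
        · simp [hi]
      · let ρ : ℕ → ℕ := fun v =>
          if ∃ y ∈ A.vars, y ∈ C.vars ∧ vis y ∧ g y = v then r C v else Nat.pair N v
        refine ⟨ρ, fun v => ?_, fun v => ?_, ?_, ?_⟩
        · by_cases hv : ∃ y ∈ A.vars, y ∈ C.vars ∧ vis y ∧ g y = v
          · simp only [ρ, if_pos hv, hdec C hC]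
          · simp only [ρ, if_neg hv, Nat.unpair_pair]
        · by_cases hv : ∃ y ∈ A.vars, y ∈ C.vars ∧ vis y ∧ g y = v
          · simp only [ρ, if_pos hv]
            exact (hN C hC v).trans (Nat.lt_succ_self _)
          · simp only [ρ, if_neg hv, Nat.unpair_pair]
            exact Nat.lt_succ_self _
        · by_cases hmem : mapAtom ρ (i A) ∈ B.image fun A => mapAtom (r A) (i A)
          · rw [Finset.insert_eq_of_mem hmem]
            exact hear
          · refine .extend hear (Finset.mem_image_of_mem _ hC) hmem fun z hz => ?_
            obtain ⟨hz, hzB⟩ := Finset.mem_inter.1 hz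
            obtain ⟨v, -, rfl⟩ := mem_vars_mapAtom.1 hz
            by_cases hv : ∃ y ∈ A.vars, y ∈ C.vars ∧ vis y ∧ g y = v
            · obtain ⟨y, -, hyC, hy, rfl⟩ := id hv
              exact mem_vars_mapAtom.2 ⟨g y, hvis C hCi y hyC hy, by simp only [ρ, if_pos hv]⟩
            · obtain ⟨_, hF, hzD⟩ := mem_varsOf.1 hzB
              obtain ⟨D, hD, rfl⟩ := Finset.mem_image.1 hF
              obtain ⟨u, -, hu⟩ := mem_vars_mapAtom.1 hzD
              have := hN D hD u
              simp only [hu, ρ, if_neg hv, Nat.unpair_pair, lt_irrefl] at this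
        · intro y hyA hyC
          refine ⟨fun hy => if_pos ⟨y, hyA, hyC, hy, rfl⟩, fun hy => ?_⟩
          exact absurd (hinvis A hAi C hCi y hyA hyC hy) hi
    have hold : ∀ D ∈ B, Function.update r A ρ D = r D := fun D hD =>
      Function.update_of_ne (ne_of_mem_of_not_mem hD hA) _ _
    have hnew : Function.update r A ρ A = ρ := Function.update_self _ _ _
    have hAD : ∀ D ∈ B, ∀ y ∈ A.vars, y ∈ D.vars → (vis y → ρ (g y) = r D (g y)) ∧
        (¬ vis y → mapAtom ρ (i A) = mapAtom (r D) (i D)) := by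
      intro D hD y hyA hyD
      have hyC := hsub (Finset.mem_inter.2 ⟨hyA, mem_varsOf.2 ⟨D, hD, hyD⟩⟩)
      have h₁ := hρagree y hyA hyC
      have h₂ := hagree C hC D hD y hyC hyD
      exact ⟨fun hy => (h₁.1 hy).trans (h₂.1 hy), fun hy => (h₁.2 hy).trans (h₂.2 hy)⟩
    refine ⟨Function.update r A ρ, ⟨?_, ?_, ?_⟩, N + 1, ?_⟩
    · intro D hD
      rcases Finset.mem_insert.1 hD with rfl | hD
      · rwa [hnew]
      · rw [hold D hD]
        exact hdec D hD
    · have himage : (B.image fun D => mapAtom (Function.update r A ρ D) (i D)) =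
          B.image fun D => mapAtom (r D) (i D) :=
        Finset.image_congr fun D hD => by rw [hold D (Finset.mem_coe.1 hD)]
      rwa [Finset.image_insert, hnew, himage]
    · intro D hD D' hD' y hy hy'
      rcases Finset.mem_insert.1 hD with rfl | hDB <;> rcases Finset.mem_insert.1 hD' with rfl | hDB'
      · exact ⟨fun _ => rfl, fun _ => rfl⟩
      · rw [hnew, hold D' hDB']
        exact hAD D' hDB' y hy hy'
      · rw [hnew, hold D hDB]
        have := hAD D hDB y hy' hy
        exact ⟨fun h => (this.1 h).symm, fun h => (this.2 h).symm⟩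
      · rw [hold D hDB, hold D' hDB']
        exact hagree D hDB D' hDB' y hy hy'
    · intro D hD v
      rcases Finset.mem_insert.1 hD with rfl | hD
      · rw [hnew]
        exact hρN v
      · rw [hold D hD]
        exact (hN D hD v).trans (Nat.lt_succ_self _)

/-- A rewritable query maps, with the identity on visible head variables, into the union of
view bodies, one for each fact of the view image of its own body. The values `Nat.pair 0 v` are
visible, and other values belong to a single view body. -/
theorem exists_hom_to_expansion {σ : Schema} {Q : CQ} {𝒱 : Finset CQ} (hQ : isCQ σ Q)
    (h𝒱 : isViewSet σ 𝒱) (hrw : ∃ Q', isRewriting σ 𝒱 Q Q') :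
    ∃ (V : Atom → CQ) (ν α : Atom → ℕ → ℕ) (i A₀ : Atom → Atom) (h : ℕ → ℕ),
      (∀ A ∈ Q.body, V (i A) ∈ 𝒱 ∧ (∀ C ∈ (V (i A)).body, mapAtom (ν (i A)) C ∈ Q.body) ∧
        mapAtom (ν (i A)) (V (i A)).head = i A ∧ A₀ A ∈ (V (i A)).body ∧
        mapAtom (α (i A)) (A₀ A) = mapAtom h A) ∧
      (∀ f x, x ∈ (V f).head.vars → α f x = Nat.pair 0 (ν f x)) ∧
      (∀ f x, x ∉ (V f).head.vars →
        α f x = Nat.pair (Encodable.encode (f.rel, f.args) + 1) x) ∧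
      ∀ y ∈ Q.head.vars, h y = Nat.pair 0 y := by
  classical
  obtain ⟨Q', -, hQ'⟩ := hrw
  have hid : Q.head ∈ evalCQ Q' (viewDB 𝒱 ↑Q.body) := by
    rw [hQ' _ Q.body.finite_toSet hQ.2.1]
    exact ⟨fun x => x, fun A hA => by rwa [mapAtom_id], mapAtom_id _⟩
  obtain ⟨ν', hν', hhead⟩ := hid
  let K := Q'.body.image (mapAtom ν')
  have hK : ∀ f ∈ K, f ∈ viewDB 𝒱 ↑Q.body := by
    intro f hf
    obtain ⟨A, hA, rfl⟩ := Finset.mem_image.1 hf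
    exact hν' A hA
  simp only [mem_viewDB, Finset.mem_coe] at hK
  have : Nonempty CQ := ⟨Q⟩
  have : Nonempty Atom := ⟨Q.head⟩
  choose! V hV ν hν hνhead using hK
  let α : Atom → ℕ → ℕ := fun f x => if x ∈ (V f).head.vars then Nat.pair 0 (ν f x)
    else Nat.pair (Encodable.encode (f.rel, f.args) + 1) x
  let E : Finset Atom := K.biUnion fun f => (V f).body.image (mapAtom (α f))
  have hαhead : ∀ f x, x ∈ (V f).head.vars → α f x = Nat.pair 0 (ν f x) :=
    fun f x hx => if_pos hx
  have hE : isDBOver σ ↑E := by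
    intro F hF
    simp only [E, Finset.coe_biUnion, Set.mem_iUnion, Finset.mem_coe, Finset.mem_image] at hF
    obtain ⟨f, hf, A, hA, rfl⟩ := hF
    simpa [atomOver, mapAtom] using (h𝒱.1 _ (hV f hf)).2.1 A hA
  have hmem : mapAtom (Nat.pair 0) Q.head ∈ evalCQ Q' (viewDB 𝒱 ↑E) := by
    refine ⟨fun x => Nat.pair 0 (ν' x), fun A hA => ?_, by rw [← hhead, mapAtom_mapAtom]⟩
    have hf : mapAtom ν' A ∈ K := Finset.mem_image_of_mem _ hA
    refine mem_viewDB.2 ⟨_, hV _ hf, α (mapAtom ν' A), fun C hC => ?_, ?_⟩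
    · exact Finset.mem_coe.2 (Finset.mem_biUnion.2 ⟨_, hf, Finset.mem_image_of_mem _ hC⟩)
    · rw [mapAtom_eq_iff.2 (hαhead (mapAtom ν' A)), ← mapAtom_mapAtom (Nat.pair 0),
        hνhead _ hf, mapAtom_mapAtom]
  rw [hQ' _ E.finite_toSet hE] at hmem
  obtain ⟨h, hh, hhh⟩ := hmem
  simp only [E, Finset.coe_biUnion, Set.mem_iUnion, Finset.mem_coe, Finset.mem_image] at hh
  choose! i hi A₀ hA₀ hA₀eq using hh
  exact ⟨V, ν, α, i, A₀, h, fun A hA => ⟨hV _ (hi A hA), hν _ (hi A hA), hνhead _ (hi A hA),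
    hA₀ A hA, hA₀eq A hA⟩, hαhead, fun f x hx => if_neg hx, mapAtom_eq_iff.1 hhh⟩

/-- If an acyclic CQ `Q` is 𝒱-rewritable, then there is an acyclic
𝒱-rewriting of `Q`. -/
theorem statement4 (σ : Schema) (Q : CQ) (𝒱 : Finset CQ)
    (hQ : isCQ σ Q) (hacyc : isAcyclicCQ Q) (h𝒱 : isViewSet σ 𝒱)
    (hfresh : ∀ V ∈ 𝒱, Q.head.rel ≠ V.head.rel)
    (hrw : ∃ Q', isRewriting σ 𝒱 Q Q') :
    ∃ Q', isRewriting σ 𝒱 Q Q' ∧ isAcyclicCQ Q' := by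
  classical
  have : Nonempty Atom := ⟨Q.head⟩
  have : Nonempty CQ := ⟨Q⟩
  obtain ⟨V, ν, α, i, A₀, h, hi, hαvis, hαhid, hhead⟩ := exists_hom_to_expansion hQ h𝒱 hrw
  have hpre : ∀ A ∈ Q.body, ∀ y ∈ A.vars, ∃ x ∈ (A₀ A).vars, α (i A) x = h y := by
    intro A hA y hy
    rw [← mem_vars_mapAtom, (hi A hA).2.2.2.2]
    exact mem_vars_mapAtom.2 ⟨y, hy, rfl⟩
  have hvis : ∀ A ∈ Q.body, ∀ y ∈ A.vars, (h y).unpair.1 = 0 → (h y).unpair.2 ∈ (i A).vars := by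
    intro A hA y hy h0
    obtain ⟨x, -, hx⟩ := hpre A hA y hy
    by_cases hxV : x ∈ (V (i A)).head.vars
    · rw [← hx, hαvis _ _ hxV, Nat.unpair_pair, ← (hi A hA).2.2.1]
      exact mem_vars_mapAtom.2 ⟨x, hxV, by rw [(hi A hA).2.2.1]⟩
    · rw [← hx, hαhid _ _ hxV] at h0
      simp at h0
  have hcode : ∀ A ∈ Q.body, ∀ y ∈ A.vars, (h y).unpair.1 ≠ 0 →
      (h y).unpair.1 = Encodable.encode ((i A).rel, (i A).args) + 1 := by
    intro A hA y hy h0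
    obtain ⟨x, -, hx⟩ := hpre A hA y hy
    by_cases hxV : x ∈ (V (i A)).head.vars
    · rw [← hx, hαvis _ _ hxV] at h0
      simp at h0
    · rw [← hx, hαhid _ _ hxV, Nat.unpair_pair]
  have hinvis : ∀ A ∈ Q.body, ∀ C ∈ Q.body, ∀ y ∈ A.vars, y ∈ C.vars →
      ¬ (h y).unpair.1 = 0 → i A = i C := by
    intro A hA C hC y hyA hyC h0
    have := (hcode A hA y hyA h0).symm.trans (hcode C hC y hyC h0)
    have := Prod.ext_iff.1 (Encodable.encode_injective (Nat.succ_injective this))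
    exact Atom.eq_iff.2 this
  obtain ⟨r, hdec, hear, hagree⟩ := (EarOrder.of_hasJoinTree hacyc).exists_renaming i
    (fun y => (h y).unpair.1 = 0) (fun y => (h y).unpair.2) hvis hinvis
  have hmemvars : ∀ y ∈ varsOf Q.body, ∃ A ∈ Q.body, y ∈ A.vars := fun y => mem_varsOf.1
  choose! a ha hya using hmemvars
  refine ⟨⟨mapAtom (fun y => r (a y) y) Q.head,
    Q.body.image fun A => mapAtom (r A) (i A)⟩, ⟨⟨?_, ?_, hfresh, ?_⟩, ?_⟩, hear.exists_joinTree⟩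
  · exact hQ.1.image _
  · intro F hF
    obtain ⟨A, hA, rfl⟩ := Finset.mem_image.1 hF
    refine ⟨_, (hi A hA).1, ?_⟩
    have := (hi A hA).2.2.1
    rw [Atom.eq_iff] at this
    simp [mapAtom, ← this.1, ← this.2]
  · intro z hz
    obtain ⟨y, hy, rfl⟩ := mem_vars_mapAtom.1 hz
    have hyQ := hQ.2.2.2 hy
    refine mem_varsOf.2 ⟨_, Finset.mem_image_of_mem _ (ha y hyQ), mem_vars_mapAtom.2 ⟨y, ?_, rfl⟩⟩
    simpa [hhead y hy] using hvis _ (ha y hyQ) y (hya y hyQ)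
  · intro D _ _
    refine Set.Subset.antisymm ?_ ?_
    · rintro _ ⟨μ, hμ, rfl⟩
      simp only [Finset.mem_image, forall_exists_index, and_imp, forall_apply_eq_imp_iff₂] at hμ
      have hwit : ∀ F ∈ viewDB 𝒱 D, ∃ W ∈ 𝒱, ∃ w : ℕ → ℕ,
          (∀ A ∈ W.body, mapAtom w A ∈ D) ∧ mapAtom w W.head = F := fun F => mem_viewDB.1
      choose! W hW w hw hwhead using hwit
      let fact : Atom → Atom := fun A => mapAtom μ (mapAtom (r A) (i A))
      let κ : ℕ → ℕ := fun y => if (h y).unpair.1 = 0 then μ (r (a y) (h y).unpair.2)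
        else w (fact (a y)) (h y).unpair.2
      refine ⟨κ, fun A hA => ?_, ?_⟩
      · obtain ⟨hVA, -, hνhead, hA₀, hA₀eq⟩ := hi A hA
        have hF : fact A ∈ viewDB 𝒱 D := hμ A hA
        have hWV : W (fact A) = V (i A) := by
          by_contra hne
          refine h𝒱.2 _ (hW _ hF) _ hVA hne ?_
          have h₁ := congrArg Atom.rel (hwhead _ hF)
          have h₂ := congrArg Atom.rel hνhead
          simp only [mapAtom, fact] at h₁ h₂ ⊢
          exact h₁.trans h₂.symm
        have key : mapAtom (w (fact A)) (A₀ A) = mapAtom κ A := by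
          refine mapAtom_eq_of_unified hA₀eq fun y hy x _ hxy => ?_
          have hyQ : y ∈ varsOf Q.body := mem_varsOf.2 ⟨A, hA, hy⟩
          have hcons := hagree A hA (a y) (ha y hyQ) y hy (hya y hyQ)
          by_cases hx : x ∈ (V (i A)).head.vars
          · have hy2 : h y = Nat.pair 0 (ν (i A) x) := by rw [← hxy, hαvis _ _ hx]
            have hwx : ∀ x ∈ (V (i A)).head.vars,
                w (fact A) x = μ (r A (ν (i A) x)) := by
              rw [← mapAtom_eq_iff, ← hWV, hwhead _ hF, hWV,
                ← mapAtom_mapAtom (fun x => μ (r A x)), hνhead, ← mapAtom_mapAtom]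
            rw [hwx x hx]
            simp only [hy2, Nat.unpair_pair, forall_const] at hcons
            simp only [κ, hy2, Nat.unpair_pair, if_true, hcons.1]
          · have hy2 := hαhid _ _ hx
            rw [hxy] at hy2
            have h0 : ¬ (h y).unpair.1 = 0 := by simp [hy2]
            have hfact : fact A = fact (a y) := congrArg (mapAtom μ) (hcons.2 h0)
            simp only [κ, if_neg h0, ← hfact]
            rw [hy2, Nat.unpair_pair]
        rw [← key]
        exact hw _ hF _ (hWV ▸ hA₀)
      · rw [mapAtom_mapAtom]
        refine mapAtom_eq_iff.2 fun y hy => ?_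
        simp [κ, hhead y hy]
    · rintro _ ⟨κ, hκ, rfl⟩
      have hproj : ∀ A ∈ Q.body,
          mapAtom (fun z => κ z.unpair.2) (mapAtom (r A) (i A)) = mapAtom κ (i A) := by
        intro A hA
        rw [mapAtom_mapAtom]
        exact mapAtom_eq_iff.2 fun v _ => by rw [hdec A hA]
      refine ⟨fun z => κ z.unpair.2, fun F hF => ?_, ?_⟩
      · obtain ⟨A, hA, rfl⟩ := Finset.mem_image.1 hF
        obtain ⟨hVA, hν, hνhead, -⟩ := hi A hA
        rw [hproj A hA]
        refine mem_viewDB.2 ⟨_, hVA, fun x => κ (ν (i A) x), fun C hC => ?_, ?_⟩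
        · rw [← mapAtom_mapAtom]
          exact hκ _ (hν C hC)
        · rw [← mapAtom_mapAtom, hνhead]
      · rw [mapAtom_mapAtom]
        exact mapAtom_eq_iff.2 fun y hy => by rw [hdec _ (ha y (hQ.2.2.2 hy))]
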